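/- Let k be a positive integer with k ≡ 2 (mod 4) and let φ ∈ J_{k,2}(O_K). Then the theta component h_{1,1} of φ (the component at s = (1+i)/2) belongs to M_{k-1}(SL(2,ℤ), ω̄). -/

import Mathlib

noncomputable section

open Complex

/-- `τ` lies in the upper half plane. -/
def UHP (τ : ℂ) : Prop := 0 < τ.im

/-- `eC w = exp(2 π i w)`. -/
def eC (w : ℂ) : ℂ := Complex.exp (2 * (Real.pi : ℂ) * Complex.I * w)

/-- Entries of a matrix in `SL(2, ℤ)`, as complex numbers. -/
def Ma (M : Matrix.SpecialLinearGroup (Fin 2) ℤ) : ℂ := ((M.1 0 0 : ℤ) : ℂ)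
def Mb (M : Matrix.SpecialLinearGroup (Fin 2) ℤ) : ℂ := ((M.1 0 1 : ℤ) : ℂ)
def Mc (M : Matrix.SpecialLinearGroup (Fin 2) ℤ) : ℂ := ((M.1 1 0 : ℤ) : ℂ)
def Md (M : Matrix.SpecialLinearGroup (Fin 2) ℤ) : ℂ := ((M.1 1 1 : ℤ) : ℂ)

/-- Hermitian Jacobi form of weight `k` and index `m` for the Hermitian Jacobi group over
`ℤ[i]`.  A form is a function `φ : ℂ → ℂ → ℂ → ℂ`, all conditions being imposed for `τ`
in the upper half plane.  Units `ε ∈ ℤ[i]ˣ = {1, -1, i, -i}`, and the elliptic variables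
`λ = p + q i`, `μ = u + v i` range over `ℤ[i]`.  The Fourier expansion is indexed by
`n ∈ ℕ` and `r = (a + b i)/2 ∈ O_K^♯ = (i/2)ℤ[i]`, supported on `N(r) ≤ n m`,
i.e. `a² + b² ≤ 4 n m`. -/
structure IsHJF (k m : ℕ) (φ : ℂ → ℂ → ℂ → ℂ) : Prop where
  holo : DifferentiableOn ℂ (fun p : ℂ × ℂ × ℂ => φ p.1 p.2.1 p.2.2) {p | UHP p.1}
  transf : ∀ ε : ℂ, ε ∈ ({1, -1, Complex.I, -Complex.I} : Set ℂ) →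
    ∀ M : Matrix.SpecialLinearGroup (Fin 2) ℤ, ∀ τ z₁ z₂ : ℂ, UHP τ →
      φ ((Ma M * τ + Mb M) / (Mc M * τ + Md M))
        (ε * z₁ / (Mc M * τ + Md M))
        ((starRingEnd ℂ) ε * z₂ / (Mc M * τ + Md M))
      = ε ^ k * (Mc M * τ + Md M) ^ k *
          eC ((m : ℂ) * Mc M * z₁ * z₂ / (Mc M * τ + Md M)) * φ τ z₁ z₂
  ellip : ∀ p q u v : ℤ, ∀ τ z₁ z₂ : ℂ, UHP τ →
      φ τ (z₁ + ((p : ℂ) + (q : ℂ) * Complex.I) * τ + ((u : ℂ) + (v : ℂ) * Complex.I))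
          (z₂ + ((p : ℂ) - (q : ℂ) * Complex.I) * τ + ((u : ℂ) - (v : ℂ) * Complex.I))
      = eC (-(m : ℂ) * (((p : ℂ) ^ 2 + (q : ℂ) ^ 2) * τ
          + ((p : ℂ) - (q : ℂ) * Complex.I) * z₁
          + ((p : ℂ) + (q : ℂ) * Complex.I) * z₂)) * φ τ z₁ z₂
  fourier : ∃ c : ℕ → ℤ → ℤ → ℂ,
      (∀ (n : ℕ) (a b : ℤ), 4 * (n : ℤ) * m < a ^ 2 + b ^ 2 → c n a b = 0) ∧
      ∀ τ z₁ z₂ : ℂ, UHP τ →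
        HasSum (fun p : ℕ × ℤ × ℤ => c p.1 p.2.1 p.2.2 *
          eC ((p.1 : ℂ) * τ + (((p.2.1 : ℂ) + (p.2.2 : ℂ) * Complex.I) / 2) * z₁
            + (((p.2.1 : ℂ) - (p.2.2 : ℂ) * Complex.I) / 2) * z₂)) (φ τ z₁ z₂)

/-- Classical Jacobi form of weight `k` and index `m` for `SL(2,ℤ) ⋉ ℤ²`. -/
structure IsJF (k m : ℕ) (φ : ℂ → ℂ → ℂ) : Prop where
  holo : DifferentiableOn ℂ (fun p : ℂ × ℂ => φ p.1 p.2) {p | UHP p.1}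
  transf : ∀ M : Matrix.SpecialLinearGroup (Fin 2) ℤ, ∀ τ z : ℂ, UHP τ →
      φ ((Ma M * τ + Mb M) / (Mc M * τ + Md M)) (z / (Mc M * τ + Md M))
      = (Mc M * τ + Md M) ^ k *
          eC ((m : ℂ) * Mc M * z ^ 2 / (Mc M * τ + Md M)) * φ τ z
  ellip : ∀ p q : ℤ, ∀ τ z : ℂ, UHP τ →
      φ τ (z + (p : ℂ) * τ + (q : ℂ))
      = eC (-(m : ℂ) * ((p : ℂ) ^ 2 * τ + 2 * (p : ℂ) * z)) * φ τ z
  fourier : ∃ c : ℕ → ℤ → ℂ,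
      (∀ (n : ℕ) (r : ℤ), 4 * (n : ℤ) * m < r ^ 2 → c n r = 0) ∧
      ∀ τ z : ℂ, UHP τ →
        HasSum (fun p : ℕ × ℤ => c p.1 p.2 * eC ((p.1 : ℂ) * τ + (p.2 : ℂ) * z)) (φ τ z)

/-- Modular form of weight `k` for `SL(2,ℤ)`. -/
structure IsMF (k : ℕ) (f : ℂ → ℂ) : Prop where
  holo : DifferentiableOn ℂ f {τ | UHP τ}
  transf : ∀ M : Matrix.SpecialLinearGroup (Fin 2) ℤ, ∀ τ : ℂ, UHP τ →
      f ((Ma M * τ + Mb M) / (Mc M * τ + Md M)) = (Mc M * τ + Md M) ^ k * f τ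
  bounded : ∃ A B : ℝ, ∀ τ : ℂ, B ≤ τ.im → ‖f τ‖ ≤ A

/-- Cusp form of weight `k` for `SL(2,ℤ)`. -/
structure IsCF (k : ℕ) (f : ℂ → ℂ) : Prop where
  holo : DifferentiableOn ℂ f {τ | UHP τ}
  transf : ∀ M : Matrix.SpecialLinearGroup (Fin 2) ℤ, ∀ τ : ℂ, UHP τ →
      f ((Ma M * τ + Mb M) / (Mc M * τ + Md M)) = (Mc M * τ + Md M) ^ k * f τ
  decay : ∀ ε : ℝ, 0 < ε → ∃ B : ℝ, ∀ τ : ℂ, B ≤ τ.im → ‖f τ‖ ≤ ε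

/-- `M_w(SL(2,ℤ), ω̄)` for the character `ω` of `SL(2,ℤ)` with `ω(T) = ω(S) = i`:
holomorphic functions on the upper half plane, bounded at infinity, with
`f|_w T = -i f` and `f|_w S = -i f`. -/
structure IsMFOmegaBar (w : ℕ) (f : ℂ → ℂ) : Prop where
  holo : DifferentiableOn ℂ f {τ | UHP τ}
  transT : ∀ τ : ℂ, UHP τ → f (τ + 1) = -Complex.I * f τ
  transS : ∀ τ : ℂ, UHP τ → f (-1 / τ) = -Complex.I * τ ^ w * f τ
  bounded : ∃ A B : ℝ, ∀ τ : ℂ, B ≤ τ.im → ‖f τ‖ ≤ A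

/-- Hermitian theta function `θ^H_{m,s}` of index `m` with characteristic
`s = (a + b i)/2 ∈ O_K^♯`; the sum is over `r = s + m (g₁ + g₂ i) ∈ s + m ℤ[i]`. -/
def thetaH (m : ℕ) (a b : ℤ) (τ z₁ z₂ : ℂ) : ℂ :=
  ∑' g : ℤ × ℤ,
    eC ((((a : ℂ) + 2 * m * g.1) ^ 2 + ((b : ℂ) + 2 * m * g.2) ^ 2) / (4 * m) * τ
      + (((a : ℂ) + 2 * m * g.1) + ((b : ℂ) + 2 * m * g.2) * Complex.I) / 2 * z₁
      + (((a : ℂ) + 2 * m * g.1) - ((b : ℂ) + 2 * m * g.2) * Complex.I) / 2 * z₂)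

/-- Classical theta function `θ_{m,μ}(τ,z) = Σ_{r ≡ μ mod 2m} e(r²τ/(4m) + r z)`. -/
def thetaJ (m : ℕ) (μ : ℤ) (τ z : ℂ) : ℂ :=
  ∑' g : ℤ, eC (((μ : ℂ) + 2 * m * g) ^ 2 / (4 * m) * τ + ((μ : ℂ) + 2 * m * g) * z)

/-- `h` is the family of theta components of `φ` (for index `m`): the `h_{a,b}` depend
only on `(a, b) mod 2m` and `φ = Σ_{s ∈ O_K^♯ / m O_K} h_s θ^H_{m,s}`. -/
def HasThetaDecomp (m : ℕ) (φ : ℂ → ℂ → ℂ → ℂ) (h : ℤ → ℤ → ℂ → ℂ) : Prop :=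
  (∀ (a b : ℤ) (τ : ℂ), h (a + 2 * m) b τ = h a b τ ∧ h a (b + 2 * m) τ = h a b τ) ∧
  ∀ τ z₁ z₂ : ℂ, UHP τ →
    φ τ z₁ z₂ = ∑ a ∈ Finset.range (2 * m), ∑ b ∈ Finset.range (2 * m),
      h (a : ℤ) (b : ℤ) τ * thetaH m (a : ℤ) (b : ℤ) τ z₁ z₂

/-- `ϑ₀(τ) = Σ_{r ∈ ℤ} e(r² τ)`. -/
def theta0C (τ : ℂ) : ℂ := ∑' r : ℤ, eC ((r : ℂ) ^ 2 * τ)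

/-- `ϑ₁(τ) = Σ_{r odd} e(r² τ / 4)`. -/
def theta1C (τ : ℂ) : ℂ := ∑' r : ℤ, eC ((2 * (r : ℂ) + 1) ^ 2 * τ / 4)

/-- `ξ = ϑ₁ ϑ₀' − ϑ₀ ϑ₁'`. -/
def xiC (τ : ℂ) : ℂ := theta1C τ * deriv theta0C τ - theta0C τ * deriv theta1C τ

/-- Taylor coefficient `χ_{α,β}(τ)` of `φ(τ, z₁, z₂)` around `z₁ = z₂ = 0`. -/
def chiHJF (φ : ℂ → ℂ → ℂ → ℂ) (α β : ℕ) (τ : ℂ) : ℂ :=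
  (1 / ((α.factorial : ℂ) * (β.factorial : ℂ))) *
    iteratedDeriv α (fun z₁ => iteratedDeriv β (fun z₂ => φ τ z₁ z₂) 0) 0

/-- `D₀ : J_{k,m} → M_k`, `ψ ↦ ψ(·, 0)`. -/
def D0J (ψ : ℂ → ℂ → ℂ) : ℂ → ℂ := fun τ => ψ τ 0

/-- `D₂ : J_{k,m} → S_{k+2}`, `D₂ψ = (2k/(2πi)²) ψ₂ − (2m/(2πi)) ψ₀'`, where `ψ_ν` are
the Taylor coefficients of `ψ` around `z = 0`. -/
def D2J (k m : ℕ) (ψ : ℂ → ℂ → ℂ) : ℂ → ℂ := fun τ =>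
  (2 * (k : ℂ) / (2 * (Real.pi : ℂ) * Complex.I) ^ 2) *
      ((1 / 2) * iteratedDeriv 2 (fun z => ψ τ z) 0)
    - (2 * (m : ℂ) / (2 * (Real.pi : ℂ) * Complex.I)) * deriv (fun t => ψ t 0) τ

/-- Normalized Eisenstein series `E₄`. -/
def E4C (τ : ℂ) : ℂ :=
  1 + 240 * ∑' n : ℕ, ((ArithmeticFunction.sigma 3) n : ℂ) * eC ((n : ℂ) * τ)

/-- Normalized Eisenstein series `E₆`. -/
def E6C (τ : ℂ) : ℂ :=
  1 - 504 * ∑' n : ℕ, ((ArithmeticFunction.sigma 5) n : ℂ) * eC ((n : ℂ) * τ)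

/-- `f` agrees on the upper half plane with a polynomial in `E₄` and `E₆²` that is
homogeneous of weight `k - v`, i.e. supported on `4a + 12b + v = k`. -/
def IsE4E6sqPoly (v k : ℕ) (f : ℂ → ℂ) : Prop :=
  ∃ lam : ℕ × ℕ → ℂ, ∀ τ : ℂ, UHP τ →
    f τ = ∑ p ∈ (Finset.range (k + 1) ×ˢ Finset.range (k + 1)).filter
        (fun p => 4 * p.1 + 12 * p.2 + v = k),
      lam p * E4C τ ^ p.1 * E6C τ ^ (2 * p.2)

/-- The slash action `φ|_{k,m} M` of `M ∈ SL(2,ℤ)` on functions `ℂ → ℂ → ℂ → ℂ`. -/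
def slashHJF (k m : ℕ) (φ : ℂ → ℂ → ℂ → ℂ) (M : Matrix.SpecialLinearGroup (Fin 2) ℤ)
    (τ z₁ z₂ : ℂ) : ℂ :=
  ((Mc M * τ + Md M) ^ k)⁻¹ *
    eC (-(m : ℂ) * Mc M * z₁ * z₂ / (Mc M * τ + Md M)) *
    φ ((Ma M * τ + Mb M) / (Mc M * τ + Md M)) (z₁ / (Mc M * τ + Md M)) (z₂ / (Mc M * τ + Md M))

/-- Hermitian Jacobi form of weight `k` and index `m` for the congruence subgroup `Γ₀(N)`,
with at each cusp a Fourier expansion supported on `(n, r) ∈ ℚ_{≥0} × O_K^♯`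
with `N(r) ≤ n m`. -/
structure IsHJFLevel (k m N : ℕ) (φ : ℂ → ℂ → ℂ → ℂ) : Prop where
  holo : DifferentiableOn ℂ (fun p : ℂ × ℂ × ℂ => φ p.1 p.2.1 p.2.2) {p | UHP p.1}
  transf : ∀ ε : ℂ, ε ∈ ({1, -1, Complex.I, -Complex.I} : Set ℂ) →
    ∀ M : Matrix.SpecialLinearGroup (Fin 2) ℤ, (N : ℤ) ∣ M.1 1 0 →
    ∀ τ z₁ z₂ : ℂ, UHP τ →
      φ ((Ma M * τ + Mb M) / (Mc M * τ + Md M))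
        (ε * z₁ / (Mc M * τ + Md M))
        ((starRingEnd ℂ) ε * z₂ / (Mc M * τ + Md M))
      = ε ^ k * (Mc M * τ + Md M) ^ k *
          eC ((m : ℂ) * Mc M * z₁ * z₂ / (Mc M * τ + Md M)) * φ τ z₁ z₂
  ellip : ∀ p q u v : ℤ, ∀ τ z₁ z₂ : ℂ, UHP τ →
      φ τ (z₁ + ((p : ℂ) + (q : ℂ) * Complex.I) * τ + ((u : ℂ) + (v : ℂ) * Complex.I))
          (z₂ + ((p : ℂ) - (q : ℂ) * Complex.I) * τ + ((u : ℂ) - (v : ℂ) * Complex.I))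
      = eC (-(m : ℂ) * (((p : ℂ) ^ 2 + (q : ℂ) ^ 2) * τ
          + ((p : ℂ) - (q : ℂ) * Complex.I) * z₁
          + ((p : ℂ) + (q : ℂ) * Complex.I) * z₂)) * φ τ z₁ z₂
  cusp : ∀ M : Matrix.SpecialLinearGroup (Fin 2) ℤ,
      ∃ c : ℚ → ℤ → ℤ → ℂ,
        (∀ (n : ℚ) (a b : ℤ),
          ¬ (0 ≤ n ∧ ((a : ℚ) ^ 2 + (b : ℚ) ^ 2) ≤ 4 * n * m) → c n a b = 0) ∧
        ∀ τ z₁ z₂ : ℂ, UHP τ →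
          HasSum (fun p : ℚ × ℤ × ℤ => c p.1 p.2.1 p.2.2 *
            eC ((p.1 : ℂ) * τ + (((p.2.1 : ℂ) + (p.2.2 : ℂ) * Complex.I) / 2) * z₁
              + (((p.2.1 : ℂ) - (p.2.2 : ℂ) * Complex.I) / 2) * z₂))
            (slashHJF k m φ M τ z₁ z₂)

/-- Theta constant `x`. -/
def thConstX (τ : ℂ) : ℂ := ∑' n : ℤ, eC ((n : ℂ) ^ 2 * τ / 2)

/-- Theta constant `y`. -/
def thConstY (τ : ℂ) : ℂ := ∑' n : ℤ, (-1 : ℂ) ^ n * eC ((n : ℂ) ^ 2 * τ / 2)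

/-- Theta constant `z`. -/
def thConstZ (τ : ℂ) : ℂ := ∑' n : ℤ, eC (((n : ℂ) + 1 / 2) ^ 2 * τ / 2)

/-- The one-variable theta function of index 2, characteristic `a`. -/
def tt (a : ℕ) (τ x : ℂ) : ℂ :=
  eC ((a : ℂ) ^ 2 * τ / 8 + a * x) * jacobiTheta₂ (a * τ + 4 * x) (4 * τ)

lemma eC_add (u v : ℂ) : eC (u + v) = eC u * eC v := by
  unfold eC; rw [← Complex.exp_add]; congr 1; ring

lemma eC_int (n : ℤ) : eC n = 1 := by
  unfold eC
  rw [Complex.exp_eq_one_iff]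
  exact ⟨n, by ring⟩

lemma eC_quarter : eC (1 / 4) = Complex.I := by
  unfold eC
  refine Eq.trans ?_ Complex.exp_pi_div_two_mul_I
  congr 1; ring

lemma eC_nat_quarter (n : ℕ) : eC ((n : ℂ) / 4) = Complex.I ^ n := by
  rw [← eC_quarter]
  unfold eC
  rw [← Complex.exp_nat_mul]
  congr 1; ring

lemma im4 {τ : ℂ} (hτ : UHP τ) : 0 < (4 * τ).im := by
  unfold UHP at hτ; simp; exact hτ

lemma tt_hasSum (a : ℕ) {τ : ℂ} (hτ : UHP τ) (x : ℂ) :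
    HasSum (fun g : ℤ => eC (((a : ℂ) + 4 * g) ^ 2 / 8 * τ + ((a : ℂ) + 4 * g) * x))
      (tt a τ x) := by
  unfold tt
  have h := (hasSum_jacobiTheta₂_term (a * τ + 4 * x) (im4 hτ)).mul_left
    (eC ((a : ℂ) ^ 2 * τ / 8 + a * x))
  refine Eq.mp (congrArg (fun f => HasSum f _) (funext fun g => ?_)) h
  simp only [eC, jacobiTheta₂_term]
  rw [← Complex.exp_add]; congr 1; ring

lemma jac_split {τ : ℂ} (hτ : UHP τ) (x : ℂ) :
    jacobiTheta₂ x (τ / 4) = tt 0 τ x + tt 1 τ x + tt 2 τ x + tt 3 τ x := by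
  have hτ' : 0 < (τ / 4).im := by
    unfold UHP at hτ
    have : τ / 4 = ((1/4 : ℝ) : ℂ) * τ := by push_cast; ring
    rw [this, Complex.im_ofReal_mul]; positivity
  have h1 := hasSum_jacobiTheta₂_term x hτ'
  rw [← ((Int.divModEquiv 4).symm.trans (Equiv.refl ℤ)).hasSum_iff] at h1
  rw [← (Equiv.prodComm (Fin 4) ℤ).hasSum_iff] at h1
  have h2 := h1.prod_fiberwise (g := fun b : Fin 4 => tt b τ x) (by
    intro b
    have h := tt_hasSum b hτ x
    convert h using 1
    funext g
    simp [jacobiTheta₂_term, eC]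
    congr 1; ring)
  have h3 := h2.unique (hasSum_fintype _)
  rw [h3]
  simp [Fin.sum_univ_four]

lemma thetaH_eq (a b : ℕ) {τ : ℂ} (hτ : UHP τ) (x y : ℂ) :
    thetaH 2 (a : ℤ) (b : ℤ) τ (x - Complex.I * y) (x + Complex.I * y) = tt a τ x * tt b τ y := by
  have ha := tt_hasSum a hτ x
  have hb := tt_hasSum b hτ y
  rw [← ha.tsum_eq, ← hb.tsum_eq, tsum_mul_tsum_of_summable_norm ha.summable.norm hb.summable.norm]
  unfold thetaH
  refine tsum_congr fun g => ?_
  rw [← eC_add]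
  congr 1
  push_cast
  linear_combination (-((b : ℂ) + 4 * g.2) * y) * Complex.I_sq

lemma tt_shift (a : ℕ) (τ x : ℂ) : tt a τ (x + 1 / 4) = Complex.I ^ a * tt a τ x := by
  unfold tt
  rw [show (a : ℂ) * τ + 4 * (x + 1 / 4) = (a * τ + 4 * x) + 1 by ring, jacobiTheta₂_add_left,
    show (a : ℂ) ^ 2 * τ / 8 + a * (x + 1 / 4) = (a : ℂ) / 4 + ((a : ℂ) ^ 2 * τ / 8 + a * x) by ring,
    eC_add, eC_nat_quarter]
  ring

lemma tt_shift_nat (a j : ℕ) (τ x : ℂ) :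
    tt a τ (x + (j : ℂ) / 4) = (Complex.I ^ a) ^ j * tt a τ x := by
  induction j with
  | zero => simp
  | succ n ih =>
    rw [show x + ((n + 1 : ℕ) : ℂ) / 4 = (x + (n : ℂ) / 4) + 1 / 4 by push_cast; ring, tt_shift, ih]
    ring

/-- extraction of a component -/
lemma ext1 (A : ℕ → ℂ) (τ : ℂ) (f : ℂ → ℂ)
    (hf : ∀ x, f x = ∑ a ∈ Finset.range 4, A a * tt a τ x) (c : ℕ) (hc : c < 4) (x : ℂ) :
    ∑ j ∈ Finset.range 4, ((-Complex.I) ^ c) ^ j * f (x + (j : ℂ) / 4) = 4 * A c * tt c τ x := by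
  simp only [hf, tt_shift_nat, Finset.sum_range_succ, Finset.sum_range_zero]
  have h2 := Complex.I_sq
  have h3 : Complex.I ^ 3 = -Complex.I := by rw [pow_succ, h2]; ring
  have e2 : (-Complex.I) ^ 2 = -1 := by rw [neg_sq, h2]
  have e3 : (-Complex.I) ^ 3 = Complex.I := by rw [pow_succ, e2]; ring
  have m2 : (-1 : ℂ) ^ 2 = 1 := by norm_num
  have m3 : (-1 : ℂ) ^ 3 = -1 := by norm_num
  interval_cases c <;> simp only [pow_zero, pow_one, h2, h3, e2, e3, one_pow, m2, m3] <;>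
    ring_nf <;> simp only [h2] <;> ring

lemma jac_zero_step {τ : ℂ} (hτ : UHP τ) (h0 : ∀ x, jacobiTheta₂ x τ = 0) (x : ℂ) :
    jacobiTheta₂ x (16 * τ) = 0 := by
  have h4 : UHP (4 * τ) := im4 hτ
  have := ext1 (fun _ => 1) (4 * τ) (fun _ => 0) (by
    intro x
    have := jac_split h4 x
    rw [show 4 * τ / 4 = τ by ring, h0] at this
    simp [Finset.sum_range_succ, this]) 0 (by norm_num) (x / 4)
  simp [tt, eC] at this
  rw [← this]; congr 1 <;> ring

lemma jac_near_one {τ : ℂ} (hτ : 4 ≤ τ.im) : 1 / 2 ≤ ‖jacobiTheta₂ 0 τ‖ := by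
  have h0 : 0 < τ.im := by linarith
  have h := norm_jacobiTheta_sub_one_le h0
  rw [jacobiTheta_eq_jacobiTheta₂] at h
  have he : Real.exp (-Real.pi * τ.im) ≤ 1 / 5 := by
    have h1 : Real.exp (-Real.pi * τ.im) ≤ Real.exp (-4) := by
      apply Real.exp_le_exp.mpr
      nlinarith [Real.pi_gt_three]
    have h2 : (5 : ℝ) ≤ Real.exp 4 := by have := Real.add_one_le_exp (4 : ℝ); linarith
    rw [Real.exp_neg] at h1
    refine h1.trans ?_
    rw [one_div]
    exact inv_anti₀ (by norm_num) h2
  have hp := Real.exp_pos (-Real.pi * τ.im)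
  set q := Real.exp (-Real.pi * τ.im)
  have h3 : 2 / (1 - q) * q ≤ 1 / 2 := by
    rw [div_mul_eq_mul_div, div_le_iff₀ (by linarith)]
    linarith
  have h4 : ‖(1 : ℂ)‖ ≤ ‖jacobiTheta₂ 0 τ‖ + ‖jacobiTheta₂ 0 τ - 1‖ := by
    have := norm_sub_le (jacobiTheta₂ 0 τ) (jacobiTheta₂ 0 τ - 1)
    simpa using this
  rw [norm_one] at h4
  linarith

lemma jac_ne {τ : ℂ} (hτ : UHP τ) : ∃ x, jacobiTheta₂ x τ ≠ 0 := by
  by_contra! h0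
  have key : ∀ n : ℕ, ∀ x, jacobiTheta₂ x (((16 ^ n : ℝ) : ℂ) * τ) = 0 := by
    intro n
    induction n with
    | zero => simpa using h0
    | succ n ih =>
      intro x
      have hU : UHP (((16 ^ n : ℝ) : ℂ) * τ) := by
        unfold UHP at *
        rw [Complex.im_ofReal_mul]; positivity
      have := jac_zero_step hU ih x
      rw [← this]; congr 1; push_cast; ring
  unfold UHP at hτ
  obtain ⟨n, hn⟩ := pow_unbounded_of_one_lt (4 / τ.im) (by norm_num : (1 : ℝ) < 16)
  have := jac_near_one (τ := ((16 ^ n : ℝ) : ℂ) * τ) (by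
    rw [Complex.im_ofReal_mul]
    rw [div_lt_iff₀ hτ] at hn
    exact hn.le)
  rw [key n 0] at this
  norm_num at this

lemma tt_ne (a : ℕ) {τ : ℂ} (hτ : UHP τ) : ∃ x, tt a τ x ≠ 0 := by
  obtain ⟨w, hw⟩ := jac_ne (τ := 4 * τ) (im4 hτ)
  refine ⟨(w - a * τ) / 4, ?_⟩
  unfold tt
  rw [show (a : ℂ) * τ + 4 * ((w - a * τ) / 4) = w by ring]
  exact mul_ne_zero (Complex.exp_ne_zero _) hw

lemma indep1 (A : ℕ → ℂ) {τ : ℂ} (hτ : UHP τ)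
    (hA : ∀ x, ∑ a ∈ Finset.range 4, A a * tt a τ x = 0) (c : ℕ) (hc : c < 4) : A c = 0 := by
  obtain ⟨x, hx⟩ := tt_ne c hτ
  have := ext1 A τ (fun _ => 0) (fun x => (hA x).symm) c hc x
  simp at this
  tauto

lemma indep2 (A B : ℕ → ℕ → ℂ) {τ : ℂ} (hτ : UHP τ)
    (hA : ∀ x y, ∑ a ∈ Finset.range 4, ∑ b ∈ Finset.range 4, A a b * (tt a τ x * tt b τ y) =
      ∑ a ∈ Finset.range 4, ∑ b ∈ Finset.range 4, B a b * (tt a τ x * tt b τ y))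
    (c d : ℕ) (hc : c < 4) (hd : d < 4) : A c d = B c d := by
  rw [← sub_eq_zero]
  refine indep1 (fun d => A c d - B c d) hτ (fun y => ?_) d hd
  refine indep1 (fun c => ∑ b ∈ Finset.range 4, (A c b - B c b) * tt b τ y) hτ (fun x => ?_) c hc
  have := hA x y
  rw [← sub_eq_zero, ← Finset.sum_sub_distrib] at this
  rw [← this]
  refine Finset.sum_congr rfl fun a _ => ?_
  rw [← Finset.sum_sub_distrib, Finset.sum_mul]
  refine Finset.sum_congr rfl fun b _ => ?_
  ring

lemma tt_neg (a : ℕ) (ha : a < 4) (τ x : ℂ) : tt a τ (-x) = tt ((4 - a) % 4) τ x := by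
  have h0 : tt 0 τ (-x) = tt 0 τ x := by
    unfold tt
    rw [← jacobiTheta₂_neg_left]
    congr 1
    · simp
    · congr 1; push_cast; ring
  have h1 : ∀ x, tt 1 τ (-x) = tt 3 τ x := by
    intro x
    unfold tt
    rw [← jacobiTheta₂_neg_left]
    rw [show ((3 : ℕ) : ℂ) * τ + 4 * x = (-(((1 : ℕ) : ℂ) * τ + 4 * (-x))) + 4 * τ by push_cast; ring,
      jacobiTheta₂_add_left', ← mul_assoc]
    congr 1
    unfold eC
    rw [← Complex.exp_add]
    congr 1; push_cast; ring
  have h2 : tt 2 τ (-x) = tt 2 τ x := by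
    unfold tt
    rw [← jacobiTheta₂_neg_left]
    rw [show ((2 : ℕ) : ℂ) * τ + 4 * x = (-(((2 : ℕ) : ℂ) * τ + 4 * (-x))) + 4 * τ by push_cast; ring,
      jacobiTheta₂_add_left', ← mul_assoc]
    congr 1
    unfold eC
    rw [← Complex.exp_add]
    congr 1; push_cast; ring
  interval_cases a
  · exact h0
  · exact h1 x
  · exact h2
  · have := h1 (-x)
    rw [neg_neg] at this
    exact this.symm

lemma UHP_ne {τ : ℂ} (hτ : UHP τ) : τ ≠ 0 := by
  rintro rfl; simp [UHP] at hτ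

lemma UHP_S {τ : ℂ} (hτ : UHP τ) : UHP (-1 / τ) := by
  have h0 := UHP_ne hτ
  unfold UHP at *
  rw [neg_div, Complex.neg_im, one_div, Complex.inv_im, neg_div, neg_neg]
  have := Complex.normSq_pos.mpr h0
  positivity

lemma tt_shift_neg (c a : ℕ) (τ x : ℂ) :
    tt c τ (x - (a : ℂ) / 4) = ((-Complex.I) ^ c) ^ a * tt c τ x := by
  have := tt_shift_nat c a τ (x - (a : ℂ) / 4)
  rw [sub_add_cancel] at this
  rw [this, ← mul_assoc, ← mul_pow, ← mul_pow]
  simp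

lemma tt_S (a : ℕ) {τ : ℂ} (hτ : UHP τ) (x : ℂ) :
    tt a (-1 / τ) (x / τ) = (-Complex.I * (τ / 4)) ^ (1 / 2 : ℂ) * eC (2 * x ^ 2 / τ) *
      ∑ c ∈ Finset.range 4, ((-Complex.I) ^ c) ^ a * tt c τ x := by
  have h0 := UHP_ne hτ
  have hs : ∑ c ∈ Finset.range 4, ((-Complex.I) ^ c) ^ a * tt c τ x
      = jacobiTheta₂ (x - a / 4) (τ / 4) := by
    rw [jac_split hτ]
    simp only [tt_shift_neg, Finset.sum_range_succ, Finset.sum_range_zero]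
    ring
  have hne : (-Complex.I * (τ / 4)) ^ (1 / 2 : ℂ) ≠ 0 := by
    rw [Complex.cpow_ne_zero_iff]
    left
    simp [h0]
  rw [hs, jacobiTheta₂_functional_equation]
  unfold tt
  rw [show (a : ℂ) * (-1 / τ) + 4 * (x / τ) = (x - a / 4) / (τ / 4) by field_simp; ring,
    show 4 * (-1 / τ) = -1 / (τ / 4) by field_simp]
  rw [show (-Complex.I * (τ / 4)) ^ (1 / 2 : ℂ) * eC (2 * x ^ 2 / τ) *
    (1 / (-Complex.I * (τ / 4)) ^ (1 / 2 : ℂ) * cexp (-Real.pi * Complex.I * (x - a / 4) ^ 2 / (τ / 4)) *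
      jacobiTheta₂ ((x - a / 4) / (τ / 4)) (-1 / (τ / 4))) =
      ((-Complex.I * (τ / 4)) ^ (1 / 2 : ℂ) * (1 / (-Complex.I * (τ / 4)) ^ (1 / 2 : ℂ))) *
      (eC (2 * x ^ 2 / τ) * cexp (-Real.pi * Complex.I * (x - a / 4) ^ 2 / (τ / 4))) *
      jacobiTheta₂ ((x - a / 4) / (τ / 4)) (-1 / (τ / 4)) by ring, mul_one_div_cancel hne, one_mul]
  congr 1
  unfold eC
  rw [← Complex.exp_add]
  congr 1
  field_simp
  ring

lemma sum_swap (H w : ℕ → ℕ → ℂ) (X Y : ℕ → ℂ) :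
    ∑ a ∈ Finset.range 4, ∑ b ∈ Finset.range 4, H a b *
      ((∑ c ∈ Finset.range 4, w c a * X c) * (∑ d ∈ Finset.range 4, w d b * Y d)) =
    ∑ c ∈ Finset.range 4, ∑ d ∈ Finset.range 4,
      (∑ a ∈ Finset.range 4, ∑ b ∈ Finset.range 4, H a b * (w c a * w d b)) * (X c * Y d) := by
  simp only [Finset.sum_range_succ, Finset.sum_range_zero]
  ring

section main
variable {k : ℕ} {φ : ℂ → ℂ → ℂ → ℂ} {h : ℤ → ℤ → ℂ → ℂ}

lemma P_eq (hdec : HasThetaDecomp 2 φ h) {τ : ℂ} (hτ : UHP τ) (x y : ℂ) :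
    φ τ (x - Complex.I * y) (x + Complex.I * y) =
    ∑ a ∈ Finset.range 4, ∑ b ∈ Finset.range 4, h (a : ℤ) (b : ℤ) τ * (tt a τ x * tt b τ y) := by
  rw [hdec.2 τ _ _ hτ]
  refine Finset.sum_congr rfl fun a _ => Finset.sum_congr rfl fun b _ => ?_
  rw [thetaH_eq a b hτ]

lemma unit_rel (hk4 : k % 4 = 2) (hφ : IsHJF k 2 φ) (hdec : HasThetaDecomp 2 φ h) {τ : ℂ}
    (hτ : UHP τ) (c d : ℕ) (hc : c < 4) (hd : d < 4) :
    h (d : ℤ) (((4 - c) % 4 : ℕ) : ℤ) τ = - h (c : ℤ) (d : ℤ) τ := by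
  refine indep2 (fun c d => h (d : ℤ) (((4 - c) % 4 : ℕ) : ℤ) τ) (fun c d => - h (c : ℤ) (d : ℤ) τ)
    hτ (fun x y => ?_) c d hc hd
  have hu := hφ.transf Complex.I (by simp) 1 τ (x - Complex.I * y) (x + Complex.I * y) hτ
  have hIk : Complex.I ^ k = -1 := by
    rw [← Nat.div_add_mod k 4, hk4, pow_add, pow_mul, Complex.I_pow_four]; simp
  simp only [Ma, Mb, Mc, Md, eC] at hu
  simp [hIk] at hu
  rw [show Complex.I * (x - Complex.I * y) = y - Complex.I * (-x) by
      linear_combination (-y) * Complex.I_sq,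
    show -(Complex.I * (x + Complex.I * y)) = y + Complex.I * (-x) by
      linear_combination (-y) * Complex.I_sq, P_eq hdec hτ, P_eq hdec hτ] at hu
  simp only [Finset.sum_range_succ, Finset.sum_range_zero, tt_neg 0 (by norm_num), tt_neg 1 (by norm_num),
    tt_neg 2 (by norm_num), tt_neg 3 (by norm_num)] at hu ⊢
  norm_num at hu ⊢
  linear_combination hu

lemma S_rel (hφ : IsHJF k 2 φ) (hdec : HasThetaDecomp 2 φ h) {τ : ℂ}
    (hτ : UHP τ) (c d : ℕ) (hc : c < 4) (hd : d < 4) :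
    τ ^ k * h (c : ℤ) (d : ℤ) τ = ∑ a ∈ Finset.range 4, ∑ b ∈ Finset.range 4,
      (-Complex.I * (τ / 4) * h (a : ℤ) (b : ℤ) (-1 / τ)) *
        (((-Complex.I) ^ c) ^ a * ((-Complex.I) ^ d) ^ b) := by
  refine indep2 (fun c d => τ ^ k * h (c : ℤ) (d : ℤ) τ) (fun c d =>
    ∑ a ∈ Finset.range 4, ∑ b ∈ Finset.range 4,
      (-Complex.I * (τ / 4) * h (a : ℤ) (b : ℤ) (-1 / τ)) *
        (((-Complex.I) ^ c) ^ a * ((-Complex.I) ^ d) ^ b)) hτ (fun x y => ?_) c d hc hd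
  have h0 := UHP_ne hτ
  have hu := hφ.transf 1 (by simp) ModularGroup.S τ (x - Complex.I * y) (x + Complex.I * y) hτ
  simp only [Ma, Mb, Mc, Md] at hu
  simp [ModularGroup.S] at hu
  rw [show (x - Complex.I * y) / τ = x / τ - Complex.I * (y / τ) by ring,
    show (x + Complex.I * y) / τ = x / τ + Complex.I * (y / τ) by ring, P_eq hdec (UHP_S hτ),
    P_eq hdec hτ] at hu
  rw [← sum_swap (fun a b => -Complex.I * (τ / 4) * h (a : ℤ) (b : ℤ) (-1 / τ))
    (fun c a => ((-Complex.I) ^ c) ^ a) (fun c => tt c τ x) (fun d => tt d τ y)]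
  have hE : eC (2 * (x - Complex.I * y) * (x + Complex.I * y) / τ)
      = eC (2 * x ^ 2 / τ) * eC (2 * y ^ 2 / τ) := by
    rw [← eC_add]; congr 1
    field_simp
    linear_combination (-y ^ 2) * Complex.I_sq
  have hne : eC (2 * x ^ 2 / τ) * eC (2 * y ^ 2 / τ) ≠ 0 :=
    mul_ne_zero (Complex.exp_ne_zero _) (Complex.exp_ne_zero _)
  have hsq : (-Complex.I * (τ / 4)) ^ (1 / 2 : ℂ) * (-Complex.I * (τ / 4)) ^ (1 / 2 : ℂ)
      = -Complex.I * (τ / 4) := by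
    rw [← Complex.cpow_add _ _ (by simp [h0])]
    norm_num
  rw [hE] at hu
  apply mul_left_cancel₀ hne
  simp only [mul_assoc, ← Finset.mul_sum] at hu ⊢
  have e1 : eC (2 * x ^ 2 / τ) * (eC (2 * y ^ 2 / τ) * (τ ^ k * ∑ a ∈ Finset.range 4,
      ∑ b ∈ Finset.range 4, h (a : ℤ) (b : ℤ) τ * (tt a τ x * tt b τ y))) =
      τ ^ k * (eC (2 * x ^ 2 / τ) * (eC (2 * y ^ 2 / τ) * ∑ a ∈ Finset.range 4,
      ∑ b ∈ Finset.range 4, h (a : ℤ) (b : ℤ) τ * (tt a τ x * tt b τ y))) := by ring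
  refine e1.trans ?_
  rw [← hu]
  simp only [Finset.mul_sum]
  refine Finset.sum_congr rfl fun a _ => Finset.sum_congr rfl fun b _ => ?_
  rw [tt_S a hτ, tt_S b hτ]
  simp only [← Finset.mul_sum]
  linear_combination (h (a : ℤ) (b : ℤ) (-1 / τ) * eC (2 * x ^ 2 / τ) * eC (2 * y ^ 2 / τ) *
    (∑ c ∈ Finset.range 4, ((-Complex.I) ^ c) ^ a * tt c τ x) *
    (∑ c ∈ Finset.range 4, ((-Complex.I) ^ c) ^ b * tt c τ y)) * hsq

lemma main_S (hk4 : k % 4 = 2) (hφ : IsHJF k 2 φ) (hdec : HasThetaDecomp 2 φ h) {τ : ℂ}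
    (hτ : UHP τ) : h 1 1 (-1 / τ) = -Complex.I * τ ^ (k - 1) * h 1 1 τ := by
  have h0 := UHP_ne hτ
  obtain ⟨n, rfl⟩ : ∃ n, k = n + 1 := ⟨k - 1, by omega⟩
  have hS := S_rel hφ hdec hτ 1 1 (by norm_num) (by norm_num)
  have hu := unit_rel hk4 hφ hdec (UHP_S hτ)
  have u00 := hu 0 0 (by norm_num) (by norm_num)
  have u22 := hu 2 2 (by norm_num) (by norm_num)
  have u20 := hu 2 0 (by norm_num) (by norm_num)
  have u10 := hu 0 1 (by norm_num) (by norm_num)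
  have u30 := hu 0 3 (by norm_num) (by norm_num)
  have u12 := hu 2 1 (by norm_num) (by norm_num)
  have u32 := hu 2 3 (by norm_num) (by norm_num)
  have u11 := hu 1 1 (by norm_num) (by norm_num)
  have u13 := hu 1 3 (by norm_num) (by norm_num)
  have u33 := hu 3 3 (by norm_num) (by norm_num)
  norm_num at u00 u22 u20 u10 u30 u12 u32 u11 u13 u33
  have z00 : h 0 0 (-1 / τ) = 0 := by linear_combination u00 / 2
  have z22 : h 2 2 (-1 / τ) = 0 := by linear_combination u22 / 2
  have e2 : (-Complex.I) ^ 2 = -1 := by rw [neg_sq, Complex.I_sq]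
  have e3 : (-Complex.I) ^ 3 = Complex.I := by rw [pow_succ, e2]; ring
  simp only [Finset.sum_range_succ, Finset.sum_range_zero, pow_one, pow_zero, e2, e3] at hS
  have e13 : h 1 3 (-1 / τ) = -h 1 1 (-1 / τ) := by linear_combination u11
  have e33 : h 3 3 (-1 / τ) = h 1 1 (-1 / τ) := by linear_combination u13 - e13
  have e31 : h 3 1 (-1 / τ) = -h 1 1 (-1 / τ) := by linear_combination u33 - e33
  have i2 := Complex.I_sq
  have i3 : Complex.I ^ 3 = -Complex.I := by rw [pow_succ, i2]; ring
  have i4 := Complex.I_pow_four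
  push_cast at hS
  have hS' : τ ^ (n + 1) * h 1 1 τ = Complex.I * τ * h 1 1 (-1 / τ) := by
    rw [hS, z00, z22, u20, u10, u30, u12, u32, e13, e33, e31]
    ring_nf
    simp only [i2, i3, i4]
    ring
  rw [Nat.add_sub_cancel]
  apply mul_left_cancel₀ h0
  linear_combination Complex.I * hS' + τ * h 1 1 (-1 / τ) * i2

lemma ext2 (hdec : HasThetaDecomp 2 φ h) {τ : ℂ} (hτ : UHP τ) (x y : ℂ) :
    ∑ l ∈ Finset.range 4, (-Complex.I) ^ l * ∑ j ∈ Finset.range 4, (-Complex.I) ^ j *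
      φ τ ((x + (j : ℂ) / 4) - Complex.I * (y + (l : ℂ) / 4))
        ((x + (j : ℂ) / 4) + Complex.I * (y + (l : ℂ) / 4)) =
      16 * h 1 1 τ * (tt 1 τ x * tt 1 τ y) := by
  have h1 : ∀ y, ∑ j ∈ Finset.range 4, (-Complex.I) ^ j *
      φ τ ((x + (j : ℂ) / 4) - Complex.I * y) ((x + (j : ℂ) / 4) + Complex.I * y) =
      ∑ b ∈ Finset.range 4, (4 * h 1 (b : ℤ) τ * tt 1 τ x) * tt b τ y := by
    intro y
    have := ext1 (fun a => ∑ b ∈ Finset.range 4, h (a : ℤ) (b : ℤ) τ * tt b τ y) τ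
      (fun x => φ τ (x - Complex.I * y) (x + Complex.I * y)) (by
        intro x
        rw [P_eq hdec hτ]
        refine Finset.sum_congr rfl fun a _ => ?_
        rw [Finset.sum_mul]
        refine Finset.sum_congr rfl fun b _ => ?_
        ring) 1 (by norm_num) x
    simp only [pow_one] at this
    rw [this, Finset.mul_sum, Finset.sum_mul]
    refine Finset.sum_congr rfl fun b _ => ?_
    push_cast
    ring
  have := ext1 (fun b => 4 * h 1 (b : ℤ) τ * tt 1 τ x) τ _ h1 1 (by norm_num) y
  simp only [pow_one] at this
  rw [this]
  push_cast
  ring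

lemma tt1_T (τ x : ℂ) (hτ : UHP τ) : tt 1 (τ + 1) x = eC (1 / 8) * tt 1 τ x := by
  have hτ1 : UHP (τ + 1) := by simpa [UHP] using hτ
  rw [← (tt_hasSum 1 hτ1 x).tsum_eq, ← (tt_hasSum 1 hτ x).tsum_eq, ← tsum_mul_left]
  refine tsum_congr fun g => ?_
  rw [← eC_add]
  refine Eq.trans ?_ (mul_one _)
  refine Eq.trans ?_ (congrArg _ (eC_int (g + 2 * g ^ 2)))
  rw [← eC_add]
  congr 1
  push_cast
  ring

lemma main_T (hφ : IsHJF k 2 φ) (hdec : HasThetaDecomp 2 φ h) {τ : ℂ}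
    (hτ : UHP τ) : h 1 1 (τ + 1) = -Complex.I * h 1 1 τ := by
  have hτ1 : UHP (τ + 1) := by simpa [UHP] using hτ
  obtain ⟨x, hx⟩ := tt_ne 1 hτ
  have hT : ∀ z w, φ (τ + 1) z w = φ τ z w := by
    intro z w
    have hu := hφ.transf 1 (by simp) ModularGroup.T τ z w hτ
    simp only [Ma, Mb, Mc, Md, eC] at hu
    simpa [ModularGroup.T] using hu
  have h1 := ext2 hdec hτ1 x x
  simp only [hT] at h1
  rw [ext2 hdec hτ x x, tt1_T τ x hτ] at h1
  have h8 : eC (1 / 8) * eC (1 / 8) = Complex.I := by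
    rw [← eC_add, ← eC_quarter]; congr 1; norm_num
  have h2 : h 1 1 τ = Complex.I * h 1 1 (τ + 1) := by
    apply mul_right_cancel₀ (mul_ne_zero hx hx)
    linear_combination h1 / 16 + h 1 1 (τ + 1) * tt 1 τ x * tt 1 τ x * h8
  rw [h2]
  linear_combination (h 1 1 (τ + 1)) * Complex.I_sq

lemma main_holo (hφ : IsHJF k 2 φ) (hdec : HasThetaDecomp 2 φ h) :
    DifferentiableOn ℂ (h 1 1) {τ | UHP τ} := by
  have hopen : IsOpen {τ : ℂ | UHP τ} := isOpen_lt continuous_const Complex.continuous_im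
  have hopen3 : IsOpen {p : ℂ × ℂ × ℂ | UHP p.1} := hopen.preimage continuous_fst
  intro τ₀ hτ₀
  apply DifferentiableAt.differentiableWithinAt
  obtain ⟨w, hw⟩ := jac_ne (τ := 4 * τ₀) (im4 hτ₀)
  have hJ : DifferentiableAt ℂ (fun τ => jacobiTheta₂ w (4 * τ)) τ₀ :=
    (differentiableAt_jacobiTheta₂_snd w (im4 hτ₀)).comp τ₀ (by fun_prop)
  have hN : ∀ (u v : ℂ), DifferentiableAt ℂ (fun τ => φ τ
      (((w - τ) / 4 + u) - Complex.I * ((w - τ) / 4 + v))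
      (((w - τ) / 4 + u) + Complex.I * ((w - τ) / 4 + v))) τ₀ := by
    intro u v
    have h1 : DifferentiableAt ℂ (fun p : ℂ × ℂ × ℂ => φ p.1 p.2.1 p.2.2)
      (τ₀, (((w - τ₀) / 4 + u) - Complex.I * ((w - τ₀) / 4 + v)),
      (((w - τ₀) / 4 + u) + Complex.I * ((w - τ₀) / 4 + v))) :=
      hφ.holo.differentiableAt (hopen3.mem_nhds hτ₀)
    exact h1.comp τ₀ (f := fun τ : ℂ => (τ, (((w - τ) / 4 + u) - Complex.I * ((w - τ) / 4 + v)),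
      (((w - τ) / 4 + u) + Complex.I * ((w - τ) / 4 + v)))) (by fun_prop)
  have hden : DifferentiableAt ℂ (fun τ => 16 * (tt 1 τ ((w - τ) / 4) * tt 1 τ ((w - τ) / 4))) τ₀ ∧
      tt 1 τ₀ ((w - τ₀) / 4) ≠ 0 ∧ ∀ᶠ τ in nhds τ₀, tt 1 τ ((w - τ) / 4) ≠ 0 := by
    have e : (fun τ => tt 1 τ ((w - τ) / 4)) = fun τ =>
        Complex.exp (2 * (Real.pi : ℂ) * Complex.I * (τ / 8 + (w - τ) / 4)) *
          jacobiTheta₂ w (4 * τ) := by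
      funext τ
      simp only [tt, eC]
      push_cast
      rw [show 1 * τ + 4 * ((w - τ) / 4) = w by ring]
      congr 3; ring
    have hd : DifferentiableAt ℂ (fun τ => tt 1 τ ((w - τ) / 4)) τ₀ := by
      rw [e]
      exact DifferentiableAt.mul (by fun_prop) hJ
    have hne : tt 1 τ₀ ((w - τ₀) / 4) ≠ 0 := by
      rw [show tt 1 τ₀ ((w - τ₀) / 4) = _ from congrFun e τ₀]
      exact mul_ne_zero (Complex.exp_ne_zero _) hw
    exact ⟨(hd.mul hd).const_mul 16, hne, hd.continuousAt.eventually_ne hne⟩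
  have hnum : DifferentiableAt ℂ (fun τ => ∑ l ∈ Finset.range 4, (-Complex.I) ^ l *
      ∑ j ∈ Finset.range 4, (-Complex.I) ^ j *
      φ τ (((w - τ) / 4 + (j : ℂ) / 4) - Complex.I * ((w - τ) / 4 + (l : ℂ) / 4))
        (((w - τ) / 4 + (j : ℂ) / 4) + Complex.I * ((w - τ) / 4 + (l : ℂ) / 4))) τ₀ := by
    refine DifferentiableAt.fun_sum fun l _ => DifferentiableAt.const_mul ?_ _
    refine DifferentiableAt.fun_sum fun j _ => DifferentiableAt.const_mul ?_ _
    exact hN _ _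
  obtain ⟨hd, hne, hev⟩ := hden
  have hq := hnum.div hd (mul_ne_zero (by norm_num) (mul_ne_zero hne hne))
  refine hq.congr_of_eventuallyEq ?_
  filter_upwards [hev, hopen.mem_nhds hτ₀] with τ h1 h2
  simp only [Pi.div_apply]
  rw [ext2 hdec h2]
  field_simp

lemma eC_norm (w : ℂ) : ‖eC w‖ = Real.exp (-2 * Real.pi * w.im) := by
  unfold eC
  rw [Complex.norm_exp]
  congr 1
  simp

lemma main_bdd (hφ : IsHJF k 2 φ) (hdec : HasThetaDecomp 2 φ h) :
    ∃ A B : ℝ, ∀ τ : ℂ, B ≤ τ.im → ‖h 1 1 τ‖ ≤ A := by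
  obtain ⟨c, hc0, hc⟩ := hφ.fourier
  -- each term, at `x = -τ/4 + u`, `y = -τ/4 + v`
  have hterm : ∀ (τ : ℂ) (u v : ℝ) (n : ℕ) (a b : ℤ),
      ‖eC (τ / 4) * (c n a b * eC ((n : ℂ) * τ + (((a : ℂ) + (b : ℂ) * Complex.I) / 2) *
        ((-τ / 4 + u) - Complex.I * (-τ / 4 + v))
        + (((a : ℂ) - (b : ℂ) * Complex.I) / 2) * ((-τ / 4 + u) + Complex.I * (-τ / 4 + v))))‖
      = ‖c n a b‖ * Real.exp (-2 * Real.pi * (((n : ℝ) - (a + b) / 4 + 1 / 4) * τ.im)) := by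
    intro τ u v n a b
    rw [mul_left_comm, ← eC_add, norm_mul, eC_norm]
    congr 4
    have : τ / 4 + ((n : ℂ) * τ + (((a : ℂ) + (b : ℂ) * Complex.I) / 2) *
        ((-τ / 4 + u) - Complex.I * (-τ / 4 + v))
        + (((a : ℂ) - (b : ℂ) * Complex.I) / 2) * ((-τ / 4 + u) + Complex.I * (-τ / 4 + v)))
        = (((n : ℝ) - (a + b) / 4 + 1 / 4 : ℝ) : ℂ) * τ + ((a * u + b * v : ℝ) : ℂ) := by
      push_cast
      linear_combination (-(b : ℂ) * (-τ / 4 + v)) * Complex.I_sq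
    rw [this, Complex.add_im, Complex.im_ofReal_mul, Complex.ofReal_im, add_zero]
  have hI : UHP Complex.I := by simp [UHP]
  set D : ℕ × ℤ × ℤ → ℝ := fun p => ‖c p.1 p.2.1 p.2.2‖ *
    Real.exp (-2 * Real.pi * (((p.1 : ℝ) - (p.2.1 + p.2.2) / 4 + 1 / 4) * 1)) with hD
  have hDs : Summable D := by
    have h1 := ((hc Complex.I ((-Complex.I / 4 + (0 : ℝ)) - Complex.I * (-Complex.I / 4 + (0 : ℝ)))
      ((-Complex.I / 4 + (0 : ℝ)) + Complex.I * (-Complex.I / 4 + (0 : ℝ))) hI).mul_left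
      (eC (Complex.I / 4))).summable.norm
    refine h1.congr fun p => ?_
    rw [hterm, Complex.I_im]
  have hφb : ∀ (τ : ℂ) (u v : ℝ), 1 ≤ τ.im → ‖eC (τ / 4) *
      φ τ ((-τ / 4 + u) - Complex.I * (-τ / 4 + v)) ((-τ / 4 + u) + Complex.I * (-τ / 4 + v))‖
      ≤ ∑' p, D p := by
    intro τ u v hτ
    have hU : UHP τ := by unfold UHP; linarith
    have h1 := (hc τ ((-τ / 4 + u) - Complex.I * (-τ / 4 + v))
      ((-τ / 4 + u) + Complex.I * (-τ / 4 + v)) hU).mul_left (eC (τ / 4))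
    rw [← h1.tsum_eq]
    refine tsum_of_norm_bounded hDs.hasSum fun p => ?_
    rw [hterm]
    simp only [hD]
    by_cases hp : 4 * (p.1 : ℤ) * (2 : ℕ) < p.2.1 ^ 2 + p.2.2 ^ 2
    · rw [hc0 _ _ _ hp]; simp
    · push Not at hp
      have hp' : (p.2.1 : ℝ) ^ 2 + (p.2.2 : ℝ) ^ 2 ≤ 8 * (p.1 : ℝ) := by
        have : ((p.2.1 ^ 2 + p.2.2 ^ 2 : ℤ) : ℝ) ≤ ((4 * (p.1 : ℤ) * (2 : ℕ) : ℤ) : ℝ) := by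
          exact_mod_cast hp
        push_cast at this
        linarith
      have hν : 0 ≤ (p.1 : ℝ) - (p.2.1 + p.2.2) / 4 + 1 / 4 := by
        nlinarith [sq_nonneg ((p.2.1 : ℝ) - 1), sq_nonneg ((p.2.2 : ℝ) - 1)]
      refine mul_le_mul_of_nonneg_left (Real.exp_le_exp.mpr ?_) (norm_nonneg _)
      have h3 := mul_le_mul_of_nonneg_left hτ hν
      nlinarith [Real.pi_pos]
  set A := ∑' p, D p
  refine ⟨4 * A, 1, fun τ hτ => ?_⟩
  have hU : UHP τ := by unfold UHP; linarith
  have hj : 1 / 2 ≤ ‖jacobiTheta₂ 0 (4 * τ)‖ := jac_near_one (by simp; linarith)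
  have h2 := ext2 hdec hU (-τ / 4) (-τ / 4)
  have ht : eC (τ / 4) * (tt 1 τ (-τ / 4) * tt 1 τ (-τ / 4)) =
      jacobiTheta₂ 0 (4 * τ) * jacobiTheta₂ 0 (4 * τ) := by
    unfold tt
    rw [show ((1 : ℕ) : ℂ) * τ + 4 * (-τ / 4) = 0 by push_cast; ring]
    have : eC (τ / 4) * (eC (((1 : ℕ) : ℂ) ^ 2 * τ / 8 + ((1 : ℕ) : ℂ) * (-τ / 4)) *
      eC (((1 : ℕ) : ℂ) ^ 2 * τ / 8 + ((1 : ℕ) : ℂ) * (-τ / 4))) = 1 := by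
      rw [← eC_add, ← eC_add]
      convert eC_int 0 using 2
      push_cast; ring
    linear_combination jacobiTheta₂ 0 (4 * τ) * jacobiTheta₂ 0 (4 * τ) * this
  have h3 : 16 * h 1 1 τ * (jacobiTheta₂ 0 (4 * τ) * jacobiTheta₂ 0 (4 * τ)) =
      ∑ l ∈ Finset.range 4, ∑ j ∈ Finset.range 4, (-Complex.I) ^ l * (-Complex.I) ^ j *
      (eC (τ / 4) * φ τ ((-τ / 4 + ((j / 4 : ℝ) : ℂ)) - Complex.I * (-τ / 4 + ((l / 4 : ℝ) : ℂ)))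
        ((-τ / 4 + ((j / 4 : ℝ) : ℂ)) + Complex.I * (-τ / 4 + ((l / 4 : ℝ) : ℂ)))) := by
    rw [← ht, mul_left_comm, ← h2, Finset.mul_sum]
    refine Finset.sum_congr rfl fun l _ => ?_
    rw [Finset.mul_sum, Finset.mul_sum]
    refine Finset.sum_congr rfl fun j _ => ?_
    push_cast
    ring
  have h4 : ‖16 * h 1 1 τ * (jacobiTheta₂ 0 (4 * τ) * jacobiTheta₂ 0 (4 * τ))‖ ≤ 16 * A := by
    rw [h3]
    have : (16 : ℝ) * A = ∑ l ∈ Finset.range 4, ∑ j ∈ Finset.range 4, A := by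
      simp; ring
    rw [this]
    refine norm_sum_le_of_le _ fun l _ => norm_sum_le_of_le _ fun j _ => ?_
    rw [norm_mul, norm_mul, norm_pow, norm_pow]
    simp only [norm_neg, Complex.norm_I, one_pow, one_mul]
    exact hφb τ _ _ hτ
  rw [norm_mul, norm_mul, norm_mul] at h4
  have h16 : ‖(16 : ℂ)‖ = 16 := by simp
  rw [h16] at h4
  have h5 : 1 / 4 ≤ ‖jacobiTheta₂ 0 (4 * τ)‖ * ‖jacobiTheta₂ 0 (4 * τ)‖ := by nlinarith
  have h6 := mul_le_mul_of_nonneg_left h5 (norm_nonneg (h 1 1 τ))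
  linarith

end main

/-- for `k ≡ 2 (mod 4)` and `φ ∈ J_{k,2}(O_K)`, the theta component
`h_{1,1}` (at `s = (1+i)/2`) lies in `M_{k-1}(SL(2,ℤ), ω̄)`. -/
theorem stmt11 (k : ℕ) (hk : 0 < k) (hk4 : k % 4 = 2)
    (φ : ℂ → ℂ → ℂ → ℂ) (h : ℤ → ℤ → ℂ → ℂ)
    (hφ : IsHJF k 2 φ) (hdec : HasThetaDecomp 2 φ h) :
    IsMFOmegaBar (k - 1) (h 1 1) := by 
  exact ⟨main_holo hφ hdec, fun τ hτ => main_T hφ hdec hτ, fun τ hτ => main_S hk4 hφ hdec hτ,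
    main_bdd hφ hdec⟩
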